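/- The double integral ∫_ℝ [ ∫_ℝ ( ∫_0^z H(u,x) du )² f(z) dz ] dx is finite, where the inner integral ∫_0^z is the signed integral from 0 to z. -/

import Mathlib

open MeasureTheory

set_option maxHeartbeats 2000000

lemma aux_decay (S : ℝ → ℝ) (hS : Continuous S) (A γ : ℝ) (hA : 0 < A)
    (hSr : ∀ x, A < x → S x ≤ -γ) :
    ∃ D : ℝ, 0 < D ∧ ∀ x y, 0 ≤ x → x ≤ y →
      Real.exp (2 * ∫ t in (0:ℝ)..y, S t) ≤
        D * Real.exp (2 * ∫ t in (0:ℝ)..x, S t) * Real.exp (-(2 * γ) * (y - x)) := by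
  set g : ℝ → ℝ := fun t => max (S t + γ) 0 with hg
  have hgc : Continuous g := by fun_prop
  refine ⟨Real.exp (2 * ∫ t in (0:ℝ)..A, g t), Real.exp_pos _, fun x y hx hxy => ?_⟩
  rw [← Real.exp_add, ← Real.exp_add]
  apply Real.exp_le_exp.2
  have h1 : (∫ t in (0:ℝ)..x, S t) + ∫ t in x..y, S t = ∫ t in (0:ℝ)..y, S t :=
    intervalIntegral.integral_add_adjacent_intervals (hS.intervalIntegrable _ _)
      (hS.intervalIntegrable _ _)
  have h2 : ∫ t in x..y, (S t + γ) = (∫ t in x..y, S t) + γ * (y - x) := by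
    rw [intervalIntegral.integral_add (hS.intervalIntegrable _ _) (by simp)]
    simp [mul_comm]
  have h3 : ∫ t in x..y, (S t + γ) ≤ ∫ t in x..y, g t := by
    apply intervalIntegral.integral_mono_on hxy
    · exact (hS.add continuous_const).intervalIntegrable _ _
    · exact hgc.intervalIntegrable _ _
    · intro t _; exact le_max_left _ _
  have h4 : ∫ t in x..y, g t ≤ ∫ t in (0:ℝ)..(max A y), g t := by
    apply intervalIntegral.integral_mono_interval hx hxy (le_max_right _ _)
    · exact Filter.Eventually.of_forall fun t => le_max_right _ _
    · exact hgc.intervalIntegrable _ _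
  have h5 : (∫ t in (0:ℝ)..A, g t) + ∫ t in A..(max A y), g t = ∫ t in (0:ℝ)..(max A y), g t :=
    intervalIntegral.integral_add_adjacent_intervals (hgc.intervalIntegrable _ _)
      (hgc.intervalIntegrable _ _)
  have h6 : ∫ t in A..(max A y), g t = 0 := by
    rw [intervalIntegral.integral_of_le (le_max_left _ _)]
    apply setIntegral_eq_zero_of_forall_eq_zero
    intro t ht
    have := hSr t ht.1
    simp only [hg]
    exact max_eq_right (by linarith)
  nlinarith

lemma aux_tail (w : ℝ → ℝ) (hw : Continuous w) (hp : ∀ x, 0 < w x) (D c : ℝ)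
    (hc : 0 < c)
    (h : ∀ x y, 0 ≤ x → x ≤ y → w y ≤ D * w x * Real.exp (-c * (y - x))) :
    IntegrableOn w (Set.Ioi 0) ∧ ∀ x, 0 ≤ x → ∫ t in Set.Ioi x, w t ≤ D / c * w x := by
  have key : ∀ x, 0 ≤ x → IntegrableOn (fun y => D * w x * Real.exp (-c * (y - x))) (Set.Ioi x) ∧
      ∫ y in Set.Ioi x, D * w x * Real.exp (-c * (y - x)) = D / c * w x := by
    intro x hx
    have e : (fun y => D * w x * Real.exp (-c * (y - x))) =
        fun y => (D * w x * Real.exp (c * x)) * Real.exp (-c * y) := by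
      funext y
      rw [mul_assoc _ (Real.exp (c * x)), ← Real.exp_add]; congr 2; ring
    rw [e]
    refine ⟨(integrableOn_exp_mul_Ioi (by linarith) x).const_mul _, ?_⟩
    rw [integral_const_mul, integral_exp_mul_Ioi (by linarith) x]
    have : Real.exp (c * x) * Real.exp (-c * x) = 1 := by
      rw [← Real.exp_add]; simp
    have e2 : D * w x * Real.exp (c * x) * (-Real.exp (-c * x) / -c) =
        D / c * w x * (Real.exp (c * x) * Real.exp (-c * x)) := by
      rw [neg_div_neg_eq]; ring
    rw [e2, this, mul_one]
  have hi : ∀ x, 0 ≤ x → IntegrableOn w (Set.Ioi x) := by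
    intro x hx
    refine Integrable.mono' (key x hx).1 hw.aestronglyMeasurable ?_
    filter_upwards [ae_restrict_mem measurableSet_Ioi] with y hy
    rw [Real.norm_of_nonneg (hp y).le]
    exact h x y hx (le_of_lt hy)
  refine ⟨hi 0 le_rfl, fun x hx => ?_⟩
  rw [← (key x hx).2]
  exact setIntegral_mono_on (hi x hx) (key x hx).1 measurableSet_Ioi
    fun y hy => h x y hx (le_of_lt hy)

lemma aux_half (P Q f : ℝ → ℝ) (C D a c : ℝ) (hC : 0 < C) (hD : 0 < D) (ha : 0 < a)
    (hac : a ≤ c) (hf : ∀ x, 0 < f x)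
    (hP0 : ∀ x, 0 ≤ P x) (hQ0 : ∀ x, 0 ≤ Q x) (hP1 : ∀ x, P x ≤ 1) (hQ1 : ∀ x, Q x ≤ 1)
    (hPf : ∀ x, x ≤ 0 → P x ≤ C * f x) (hQf : ∀ x, 0 ≤ x → Q x ≤ C * f x)
    (hd : ∀ x y, 0 ≤ x → x ≤ y → f y ≤ D * f x * Real.exp (-c * (y - x)))
    (u x : ℝ) (hux : u ≤ x) :
    P u * Q x ≤ (C + C * D + C * C * D * f 0) * Real.exp (a * (|u| - |x|)) * f u := by
  have hfu := hf u
  have hf0 := hf 0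
  have hE := Real.exp_pos (a * (|u| - |x|))
  rcases le_total 0 u with hu | hu
  · have hx : 0 ≤ x := hu.trans hux
    have h1 : Real.exp (-c * (x - u)) ≤ Real.exp (a * (|u| - |x|)) := by
      apply Real.exp_le_exp.2
      rw [abs_of_nonneg hu, abs_of_nonneg hx]; nlinarith
    calc P u * Q x ≤ 1 * Q x := mul_le_mul_of_nonneg_right (hP1 u) (hQ0 x)
      _ ≤ C * f x := by rw [one_mul]; exact hQf x hx
      _ ≤ C * (D * f u * Real.exp (-c * (x - u))) := by gcongr; exact hd u x hu hux
      _ ≤ C * (D * f u * Real.exp (a * (|u| - |x|))) := by gcongr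
      _ = (C * D) * Real.exp (a * (|u| - |x|)) * f u := by ring
      _ ≤ _ := by
        gcongr
        have : 0 < C * C * D * f 0 := by positivity
        linarith
  · rcases le_total 0 x with hx | hx
    · have h1 : Real.exp (-c * (x - 0)) ≤ Real.exp (a * (|u| - |x|)) := by
        apply Real.exp_le_exp.2
        rw [abs_of_nonneg hx]; nlinarith [abs_nonneg u, mul_nonneg ha.le (abs_nonneg u)]
      calc P u * Q x ≤ (C * f u) * (C * f x) :=
            mul_le_mul (hPf u hu) (hQf x hx) (hQ0 x) (by positivity)
        _ ≤ (C * f u) * (C * (D * f 0 * Real.exp (-c * (x - 0)))) := by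
            gcongr; exact hd 0 x le_rfl hx
        _ ≤ (C * f u) * (C * (D * f 0 * Real.exp (a * (|u| - |x|)))) := by gcongr
        _ = (C * C * D * f 0) * Real.exp (a * (|u| - |x|)) * f u := by ring
        _ ≤ _ := by
          gcongr
          have : 0 < C * D := by positivity
          linarith
    · have h1 : 1 ≤ Real.exp (a * (|u| - |x|)) := by
        apply Real.one_le_exp
        rw [abs_of_nonpos hu, abs_of_nonpos hx]; nlinarith
      calc P u * Q x ≤ (C * f u) * 1 :=
            mul_le_mul (hPf u hu) (hQ1 x) (hQ0 x) (by positivity)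
        _ = C * 1 * f u := by ring
        _ ≤ C * Real.exp (a * (|u| - |x|)) * f u := by gcongr
        _ ≤ _ := by
          gcongr
          have : 0 < C * D := by positivity
          have : 0 < C * C * D * f 0 := by positivity
          linarith

lemma aux_exp_abs (b : ℝ) (hb : 0 < b) : Integrable (fun x : ℝ => Real.exp (-b * |x|)) := by
  rw [← integrableOn_univ, ← Set.Iic_union_Ioi (a := (0:ℝ))]
  apply IntegrableOn.union
  · refine (integrableOn_exp_mul_Iic hb 0).congr_fun (fun x hx => ?_) measurableSet_Iic
    simp only [abs_of_nonpos (Set.mem_Iic.1 hx)]; ring_nf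
  · refine (integrableOn_exp_mul_Ioi (neg_lt_zero.2 hb) 0).congr_fun (fun x hx => ?_)
      measurableSet_Ioi
    simp only [abs_of_pos (Set.mem_Ioi.1 hx)]

/-- The double integral `∫ [ ∫ ( ∫_0^z H(u,x) du )² f(z) dz ] dx` is finite,
where the inner integral is the signed integral from 0 to z. -/
theorem stmt_18
    (S : ℝ → ℝ) (hS : Continuous S)
    (A γ : ℝ) (hA : 0 < A) (hγ : 0 < γ)
    (hSr : ∀ x, A < x → S x ≤ -γ)
    (hSl : ∀ x, x < -A → γ ≤ S x)
    (B : ℝ → ℝ) (hB : ∀ x, B x = 2 * ∫ y in (0:ℝ)..x, S y)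
    (G : ℝ) (hG : G = ∫ y : ℝ, Real.exp (B y))
    (f : ℝ → ℝ) (hf : ∀ x, f x = Real.exp (B x) / G)
    (F : ℝ → ℝ) (hF : ∀ x, F x = ∫ y in Set.Iic x, f y)
    (H : ℝ → ℝ → ℝ)
    (hH : ∀ z x, H z x = 2 * (F (min z x) - F z * F x) / f z) :
    Integrable (fun x => ∫ z : ℝ, (∫ u in (0:ℝ)..z, H u x) ^ 2 * f z) := by
  have hBc : Continuous B := by
    have : B = fun x => 2 * ∫ y in (0:ℝ)..x, S y := funext hB
    rw [this]
    exact continuous_const.mul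
      (intervalIntegral.continuous_primitive (fun a b => hS.intervalIntegrable a b) 0)
  obtain ⟨D1, hD1, hd1⟩ := aux_decay S hS A γ hA hSr
  obtain ⟨D2, hD2, hd2⟩ := aux_decay (fun x => - S (-x)) (by fun_prop) A γ hA
    (fun x hx => by have := hSl (-x) (by linarith); linarith)
  have hBneg : ∀ x, 2 * ∫ t in (0:ℝ)..x, - S (-t) = B (-x) := by
    intro x
    rw [hB, intervalIntegral.integral_neg, intervalIntegral.integral_comp_neg,
      intervalIntegral.integral_symm]
    simp
  simp only [hBneg] at hd2
  simp only [← hB] at hd1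
  obtain ⟨D, hD, hr, hl⟩ : ∃ D : ℝ, 0 < D ∧
      (∀ x y, 0 ≤ x → x ≤ y →
        Real.exp (B y) ≤ D * Real.exp (B x) * Real.exp (-(2 * γ) * (y - x))) ∧
      (∀ x y, 0 ≤ x → x ≤ y →
        Real.exp (B (-y)) ≤ D * Real.exp (B (-x)) * Real.exp (-(2 * γ) * (y - x))) := by
    refine ⟨max D1 D2, lt_max_of_lt_left hD1, fun x y hx hy => (hd1 x y hx hy).trans ?_,
      fun x y hx hy => (hd2 x y hx hy).trans ?_⟩
    · gcongr; exact le_max_left _ _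
    · gcongr; exact le_max_right _ _
  have hc : 0 < 2 * γ := by positivity
  have hi1 := (aux_tail (fun x => Real.exp (B x)) (by fun_prop) (fun _ => Real.exp_pos _)
    D _ hc hr).1
  have hi2 := (aux_tail (fun x => Real.exp (B (-x))) (by fun_prop) (fun _ => Real.exp_pos _)
    D _ hc hl).1
  have hBi : Integrable (fun x => Real.exp (B x)) := by
    rw [← integrableOn_univ, ← Set.Iic_union_Ioi (a := (0:ℝ))]
    refine IntegrableOn.union ?_ hi1
    rw [integrableOn_Iic_iff_integrableOn_Iio]
    have hi3 : IntegrableOn (fun x => Real.exp (B (-x))) (Set.Ioi (-0)) := by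
      rw [neg_zero]; exact hi2
    have hi4 := hi3.comp_neg_Iio
    simp only [neg_neg] at hi4
    exact hi4
  have hGp : 0 < G := by rw [hG]; exact integral_exp_pos hBi
  have hfe : f = fun x => Real.exp (B x) / G := funext hf
  have hfc : Continuous f := by rw [hfe]; fun_prop
  have hfp : ∀ x, 0 < f x := fun x => by rw [hf]; positivity
  have hfi : Integrable f := by rw [hfe]; exact hBi.div_const G
  have hf1 : ∫ x, f x = 1 := by
    rw [hfe, integral_div, ← hG, div_self hGp.ne']
  have hfr : ∀ x y, 0 ≤ x → x ≤ y → f y ≤ D * f x * Real.exp (-(2 * γ) * (y - x)) := by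
    intro x y hx hy
    rw [hf, hf, div_le_iff₀ hGp]
    refine (hr x y hx hy).trans_eq ?_
    field_simp
  have hfl : ∀ x y, 0 ≤ x → x ≤ y →
      f (-y) ≤ D * f (-x) * Real.exp (-(2 * γ) * (y - x)) := by
    intro x y hx hy
    rw [hf, hf, div_le_iff₀ hGp]
    refine (hl x y hx hy).trans_eq ?_
    field_simp
  set C := D / (2 * γ) with hCdef
  have hC : 0 < C := by positivity
  have hQt := (aux_tail f hfc hfp D _ hc hfr).2
  have hPt := (aux_tail (fun x => f (-x)) (by fun_prop) (fun _ => hfp _) D _ hc hfl).2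
  have hFQ : ∀ x, 1 - F x = ∫ y in Set.Ioi x, f y := by
    intro x
    rw [hF, ← hf1, ← intervalIntegral.integral_Iic_add_Ioi (b := x) hfi.integrableOn
      hfi.integrableOn]
    ring
  have hF0 : ∀ x, 0 ≤ F x := fun x => by
    rw [hF]; exact setIntegral_nonneg measurableSet_Iic fun y _ => (hfp y).le
  have hQ0 : ∀ x, 0 ≤ 1 - F x := fun x => by
    rw [hFQ]; exact setIntegral_nonneg measurableSet_Ioi fun y _ => (hfp y).le
  have hQf : ∀ x, 0 ≤ x → 1 - F x ≤ C * f x := fun x hx => by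
    rw [hFQ]; exact hQt x hx
  have hPf : ∀ x, x ≤ 0 → F x ≤ C * f x := fun x hx => by
    have := hPt (-x) (by linarith)
    rw [integral_comp_neg_Ioi, neg_neg, ← hF] at this
    exact this
  have hFc : Continuous F := by
    have : F = fun x => F 0 + ∫ t in (0:ℝ)..x, f t := by
      funext x
      rw [← intervalIntegral.integral_Iic_sub_Iic hfi.integrableOn hfi.integrableOn, ← hF, ← hF]
      ring
    rw [this]
    exact continuous_const.add
      (intervalIntegral.continuous_primitive (fun a b => hfc.intervalIntegrable a b) 0)
  set a := γ / 4 with hadef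
  have ha : 0 < a := by positivity
  have hac : a ≤ 2 * γ := by rw [hadef]; linarith
  set K := C + C * D + C * C * D * f 0 with hK
  have hKp : 0 < K := by have := hfp 0; positivity
  have hHb : ∀ u x, |H u x| ≤ 2 * K * Real.exp (a * (|u| - |x|)) := by
    intro u x
    rw [hH, abs_div, abs_of_pos (hfp u), div_le_iff₀ (hfp u)]
    rcases le_total u x with hux | hux
    · have := aux_half F (fun x => 1 - F x) f C D a _ hC hD ha hac hfp hF0 hQ0
        (fun x => by linarith [hQ0 x]) (fun x => by linarith [hF0 x]) hPf hQf hfr u x hux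
      rw [min_eq_left hux, abs_of_nonneg (by nlinarith [mul_nonneg (hF0 u) (hQ0 x)])]
      nlinarith
    · have := aux_half (fun x => 1 - F (-x)) (fun x => F (-x)) (fun x => f (-x)) C D a _ hC hD
        ha hac (fun _ => hfp _) (fun _ => hQ0 _) (fun _ => hF0 _)
        (fun x => by linarith [hF0 (-x)]) (fun x => by linarith [hQ0 (-x)])
        (fun x hx => hQf _ (by linarith)) (fun x hx => hPf _ (by linarith)) hfl
        (-u) (-x) (by linarith)
      simp only [neg_neg, abs_neg, neg_zero] at this
      rw [min_eq_right hux, abs_of_nonneg (by nlinarith [mul_nonneg (hF0 x) (hQ0 u)])]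
      nlinarith
  have hIb : ∀ x z, |∫ u in (0:ℝ)..z, H u x| ≤
      (2 * K / a) * Real.exp (2 * a * |z|) * Real.exp (-a * |x|) := by
    intro x z
    have h1 : ‖∫ u in (0:ℝ)..z, H u x‖ ≤ (2 * K * Real.exp (a * (|z| - |x|))) * |z - 0| := by
      apply intervalIntegral.norm_integral_le_of_norm_le_const
      intro u hu
      refine (hHb u x).trans ?_
      have : |u| ≤ |z| := by
        rcases Set.mem_uIoc.1 hu with h | h
        · rw [abs_of_pos h.1, abs_of_nonneg (h.1.le.trans h.2)]; exact h.2
        · rw [abs_of_nonpos h.2, abs_of_nonpos (h.1.le.trans h.2)]; linarith [h.1]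
      gcongr
    rw [Real.norm_eq_abs, sub_zero] at h1
    have h2 : |z| ≤ Real.exp (a * |z|) / a := by
      rw [le_div_iff₀ ha]; linarith [Real.add_one_le_exp (a * |z|)]
    calc _ ≤ _ := h1
      _ ≤ (2 * K * Real.exp (a * (|z| - |x|))) * (Real.exp (a * |z|) / a) := by gcongr
      _ = (2 * K / a) * (Real.exp (a * (|z| - |x|)) * Real.exp (a * |z|)) := by ring
      _ = (2 * K / a) * (Real.exp (2 * a * |z|) * Real.exp (-a * |x|)) := by
        rw [← Real.exp_add, ← Real.exp_add]; ring_nf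
      _ = _ := by ring
  have hfb : ∀ z, f z ≤ D * f 0 * Real.exp (-(2 * γ) * |z|) := by
    intro z
    rcases le_total 0 z with hz | hz
    · have := hfr 0 z le_rfl hz
      rw [sub_zero] at this
      rwa [abs_of_nonneg hz]
    · have := hfl 0 (-z) le_rfl (by linarith)
      rwa [neg_neg, neg_zero, sub_zero, ← abs_of_nonpos hz] at this
  set M := (2 * K / a) ^ 2 * (D * f 0) with hM
  have hb : ∀ x z, ‖(∫ u in (0:ℝ)..z, H u x) ^ 2 * f z‖ ≤
      (M * Real.exp (-(2 * a) * |x|)) * Real.exp (-γ * |z|) := by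
    intro x z
    rw [norm_mul, norm_pow, Real.norm_eq_abs, Real.norm_of_nonneg (hfp z).le]
    have := hfp 0
    calc _ ≤ ((2 * K / a) * Real.exp (2 * a * |z|) * Real.exp (-a * |x|)) ^ 2 *
          (D * f 0 * Real.exp (-(2 * γ) * |z|)) := by
            gcongr
            · exact (hfp z).le
            · exact hIb x z
            · exact hfb z
      _ = M * ((Real.exp (-a * |x|) * Real.exp (-a * |x|)) *
          (Real.exp (2 * a * |z|) * Real.exp (2 * a * |z|) * Real.exp (-(2 * γ) * |z|))) := by
            rw [hM]; ring
      _ = M * (Real.exp (-(2 * a) * |x|) * Real.exp (-γ * |z|)) := by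
            simp only [← Real.exp_add]
            congr 3 <;> (try congr 1) <;> rw [hadef] <;> ring
      _ = _ := by ring
  have hHc : Continuous (fun p : (ℝ × ℝ) × ℝ => H p.2 p.1.1) := by
    simp only [hH]
    exact Continuous.div (by fun_prop) (by fun_prop) fun p => (hfp _).ne'
  have hIc : Continuous (fun p : ℝ × ℝ => (∫ u in (0:ℝ)..p.2, H u p.1) ^ 2 * f p.2) := by
    refine Continuous.mul (Continuous.pow ?_ 2) (by fun_prop)
    exact intervalIntegral.continuous_parametric_intervalIntegral_of_continuous
      (f := fun (p : ℝ × ℝ) u => H u p.1) hHc continuous_snd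
  refine Integrable.mono' (g := fun x => M * Real.exp (-(2 * a) * |x|) *
    ∫ z : ℝ, Real.exp (-γ * |z|)) ?_ ?_ ?_
  · exact ((aux_exp_abs (2 * a) (by positivity)).const_mul M).mul_const _
  · exact (hIc.stronglyMeasurable.integral_prod_right' (ν := volume)).aestronglyMeasurable
  · refine Filter.Eventually.of_forall fun x => ?_
    rw [← integral_const_mul]
    exact norm_integral_le_of_norm_le ((aux_exp_abs γ hγ).const_mul _)
      (Filter.Eventually.of_forall (hb x))
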